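/- Fix p̂ ∈ ℝ^K with p̂ ≥ 0 and Σ_{k=1}^K p̂_k = 1, fix γ ≥ 0, and let Δ = { p ∈ ℝ^K : p ≥ 0, Σ_k p_k = 1, and there exists q ∈ ℝ^K with q ≥ 0, Σ_k q_k ≤ γ, and (p_k − p̂_k)² ≤ p_k q_k for every k }. Then for every φ ∈ ℝ^K, max_{p ∈ Δ} φᵀp = inf { γω − η − 2 Σ_k p̂_k r_k + 2ω Σ_k p̂_k : ω ≥ 0, η ∈ ℝ, r ∈ ℝ^K, s ∈ ℝ^K, and for every k: φ_k ≤ s_k, s_k + η ≤ ω, and sqrt(4 r_k² + (s_k + η)²) ≤ 2ω − s_k − η }. -/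

import Mathlib

open Filter Topology

/-- The set of attainable resource vectors `(Σ p, Σ q + slack, φᵀp - slack)`. -/
def chiAttain (K : ℕ) (phat φ : Fin K → ℝ) : Set (ℝ × ℝ × ℝ) :=
  {x | ∃ p q : Fin K → ℝ, (∀ k, 0 ≤ p k) ∧ (∀ k, 0 ≤ q k) ∧
    (∀ k, (p k - phat k) ^ 2 ≤ p k * q k) ∧ ∑ k, p k = x.1 ∧ ∑ k, q k ≤ x.2.1 ∧
    x.2.2 ≤ ∑ k, φ k * p k}

lemma chi_rot_cone {u₁ u₂ p₁ p₂ q₁ q₂ a b : ℝ} (hp₁ : 0 ≤ p₁) (hp₂ : 0 ≤ p₂) (hq₁ : 0 ≤ q₁)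
    (hq₂ : 0 ≤ q₂) (ha : 0 ≤ a) (hb : 0 ≤ b) (h₁ : u₁ ^ 2 ≤ p₁ * q₁) (h₂ : u₂ ^ 2 ≤ p₂ * q₂) :
    (a * u₁ + b * u₂) ^ 2 ≤ (a * p₁ + b * p₂) * (a * q₁ + b * q₂) := by
  have h : 2 * (u₁ * u₂) ≤ p₁ * q₂ + p₂ * q₁ := by
    refine (abs_le_of_sq_le_sq' ?_ (by positivity)).2
    have := mul_le_mul h₁ h₂ (sq_nonneg _) (by positivity)
    nlinarith [sq_nonneg (p₁ * q₂ - p₂ * q₁)]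
  nlinarith [mul_le_mul_of_nonneg_left h (mul_nonneg ha hb),
    mul_le_mul_of_nonneg_left h₁ (mul_nonneg ha ha), mul_le_mul_of_nonneg_left h₂ (mul_nonneg hb hb)]

lemma chiAttain_convex (K : ℕ) (phat φ : Fin K → ℝ) : Convex ℝ (chiAttain K phat φ) := by
  rintro ⟨x, y, z⟩ ⟨p, q, hp, hq, hc, h1, h2, h3⟩ ⟨x', y', z'⟩ ⟨p', q', hp', hq', hc', h1', h2', h3'⟩
    a b ha hb hab
  simp only at h1 h2 h3 h1' h2' h3'
  refine ⟨fun k => a * p k + b * p' k, fun k => a * q k + b * q' k, fun k => ?_, fun k => ?_,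
    fun k => ?_, ?_, ?_, ?_⟩
  · have := hp k; have := hp' k; positivity
  · have := hq k; have := hq' k; positivity
  · have := chi_rot_cone (hp k) (hp' k) (hq k) (hq' k) ha hb (hc k) (hc' k)
    have e : a * p k + b * p' k - phat k = a * (p k - phat k) + b * (p' k - phat k) := by
      linear_combination (phat k) * hab
    simp only [e]; exact this
  · simp [Finset.sum_add_distrib, ← Finset.mul_sum, h1, h1']
  · simp only [Finset.sum_add_distrib, ← Finset.mul_sum, Prod.smul_mk, Prod.mk_add_mk, smul_eq_mul]
    gcongr
  · have e : ∑ k, φ k * (a * p k + b * p' k) = a * ∑ k, φ k * p k + b * ∑ k, φ k * p' k := by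
      rw [Finset.mul_sum, Finset.mul_sum, ← Finset.sum_add_distrib]
      exact Finset.sum_congr rfl fun k _ => by ring
    simp only [e, Prod.smul_mk, Prod.mk_add_mk, smul_eq_mul]
    gcongr

lemma chiAttain_closed (K : ℕ) (phat φ : Fin K → ℝ) : IsClosed (chiAttain K phat φ) := by
  apply IsSeqClosed.isClosed
  intro x l hx hl
  choose p q hp hq hc h1 h2 h3 using hx
  have l1 : Tendsto (fun n => (x n).1) atTop (𝓝 l.1) := (continuous_fst.tendsto l).comp hl
  have l2 : Tendsto (fun n => (x n).2.1) atTop (𝓝 l.2.1) :=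
    ((continuous_fst.comp continuous_snd).tendsto l).comp hl
  have l3 : Tendsto (fun n => (x n).2.2) atTop (𝓝 l.2.2) :=
    ((continuous_snd.comp continuous_snd).tendsto l).comp hl
  obtain ⟨B1, hB1⟩ := l1.bddAbove_range
  obtain ⟨B2, hB2⟩ := l2.bddAbove_range
  have hcpt : IsCompact (Set.Icc (0 : (Fin K → ℝ) × (Fin K → ℝ)) (fun _ => B1, fun _ => B2)) :=
    isCompact_Icc
  obtain ⟨⟨P, Q⟩, -, σ, hσ, hlim⟩ := hcpt.tendsto_subseq (x := fun n => (p n, q n)) (by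
    intro n
    refine ⟨⟨fun k => hp n k, fun k => hq n k⟩, fun k => ?_, fun k => ?_⟩
    · calc p n k ≤ ∑ k, p n k := Finset.single_le_sum (fun i _ => hp n i) (Finset.mem_univ k)
        _ ≤ B1 := by rw [h1]; exact hB1 ⟨n, rfl⟩
    · calc q n k ≤ ∑ k, q n k := Finset.single_le_sum (fun i _ => hq n i) (Finset.mem_univ k)
        _ ≤ B2 := (h2 n).trans (hB2 ⟨n, rfl⟩))
  have hP : ∀ k, Tendsto (fun n => p (σ n) k) atTop (𝓝 (P k)) := fun k =>
    (((continuous_apply k).comp continuous_fst).tendsto (P, Q)).comp hlim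
  have hQ : ∀ k, Tendsto (fun n => q (σ n) k) atTop (𝓝 (Q k)) := fun k =>
    (((continuous_apply k).comp continuous_snd).tendsto (P, Q)).comp hlim
  have hσ' := hσ.tendsto_atTop
  refine ⟨P, Q, fun k => ge_of_tendsto' (hP k) fun n => hp _ k,
    fun k => ge_of_tendsto' (hQ k) fun n => hq _ k,
    fun k => le_of_tendsto_of_tendsto' (((hP k).sub_const _).pow 2) ((hP k).mul (hQ k))
      fun n => hc _ k, ?_, ?_, ?_⟩
  · refine tendsto_nhds_unique (tendsto_finsetSum _ fun k _ => hP k) ?_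
    simp only [h1]; exact l1.comp hσ'
  · exact le_of_tendsto_of_tendsto' (tendsto_finsetSum _ fun k _ => hQ k) (l2.comp hσ')
      fun n => h2 _
  · exact le_of_tendsto_of_tendsto' (l3.comp hσ')
      (tendsto_finsetSum _ fun k _ => (hP k).const_mul (φ k)) fun n => h3 _

/-- One-dimensional conjugate: the supremum is approached. -/
lemma chi_conj {h t ω δ : ℝ} (hh : 0 ≤ h) (hω : 0 ≤ ω) (ht : t ≤ ω) (hδ : 0 < δ) :
    ∃ p q : ℝ, 0 ≤ p ∧ 0 ≤ q ∧ (p - h) ^ 2 ≤ p * q ∧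
      2 * ω * h - 2 * (h * Real.sqrt (ω * (ω - t))) - δ ≤ t * p - ω * q := by
  rcases hh.eq_or_lt with rfl | hh
  · exact ⟨0, 0, le_rfl, le_rfl, by simp, by simp; exact hδ.le⟩
  obtain ⟨a, rfl⟩ : ∃ a, t = ω - a := ⟨ω - t, by ring⟩
  have ha : 0 ≤ a := by linarith
  obtain ⟨p, hp, hpd⟩ : ∃ p : ℝ, 0 < p ∧
      a * p + ω * h ^ 2 / p ≤ 2 * (h * Real.sqrt (ω * a)) + δ := by
    rcases ha.eq_or_lt with rfl | ha
    · refine ⟨ω * h ^ 2 / δ + 1, by positivity, ?_⟩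
      simp only [mul_zero, Real.sqrt_zero, zero_mul, zero_add]
      rw [div_le_iff₀ (by positivity)]
      have : δ * (ω * h ^ 2 / δ + 1) = ω * h ^ 2 + δ := by field_simp
      linarith
    rcases hω.eq_or_lt with rfl | hω
    · refine ⟨δ / a, by positivity, ?_⟩
      simp only [zero_mul, mul_zero, Real.sqrt_zero, zero_add, zero_div, add_zero]
      rw [mul_div_cancel₀ _ ha.ne']
    · have hs : 0 < Real.sqrt (ω * a) := Real.sqrt_pos.2 (by positivity)
      have hs2 := Real.sq_sqrt (show 0 ≤ ω * a by positivity)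
      set σ := Real.sqrt (ω * a)
      refine ⟨h * σ / a, by positivity, ?_⟩
      have e1 : a * (h * σ / a) = h * σ := by field_simp
      have e2 : ω * h ^ 2 / (h * σ / a) = h * σ := by
        field_simp; linarith
      rw [e1, e2]; linarith
  refine ⟨p, (p - h) ^ 2 / p, hp.le, by positivity, le_of_eq (by field_simp), ?_⟩
  have e : (ω - a) * p - ω * ((p - h) ^ 2 / p) = 2 * ω * h - (a * p + ω * h ^ 2 / p) := by
    field_simp; ring
  rw [e, show ω - (ω - a) = a by ring]; linarith

lemma chi_soc {r t ω : ℝ} (hω : 0 ≤ ω) (ht : t ≤ ω) :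
    Real.sqrt (4 * r ^ 2 + t ^ 2) ≤ 2 * ω - t ↔ r ^ 2 ≤ ω * (ω - t) := by
  rw [Real.sqrt_le_left (by linarith)]
  constructor <;> intro h <;> nlinarith

/-- Pointwise weak duality. -/
lemma chi_weak {p q h t r ω : ℝ} (hp : 0 ≤ p) (hq : 0 ≤ q) (hh : 0 ≤ h) (hω : 0 ≤ ω) (ht : t ≤ ω)
    (hc : (p - h) ^ 2 ≤ p * q) (hr : r ^ 2 ≤ ω * (ω - t)) :
    t * p ≤ ω * q - 2 * (h * r) + 2 * ω * h := by
  rcases hp.eq_or_lt with rfl | hp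
  · have : h = 0 := by nlinarith
    subst this
    simp; positivity
  have key : 2 * (p * (h * r)) ≤ (ω - t) * p ^ 2 + ω * h ^ 2 := by
    have h0 : 0 ≤ ω - t := by linarith
    refine (abs_le_of_sq_le_sq' ?_ (by positivity)).2
    have := mul_le_mul_of_nonneg_left hr (show 0 ≤ (p * h) ^ 2 by positivity)
    nlinarith [sq_nonneg ((ω - t) * p ^ 2 - ω * h ^ 2)]
  have := mul_le_mul_of_nonneg_left hc hω
  refine le_of_mul_le_mul_left ?_ hp
  nlinarith

/-- Lagrange multipliers by strict separation. -/
lemma chi_mult (K : ℕ) (phat : Fin K → ℝ) (hphat : ∀ k, 0 ≤ phat k) (hphatsum : ∑ k, phat k = 1)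
    (γ : ℝ) (hγ : 0 ≤ γ) (φ : Fin K → ℝ) (V : ℝ) (hV : (1, γ, V) ∉ chiAttain K phat φ) :
    ∃ ω η : ℝ, 0 ≤ ω ∧ ∀ p q : Fin K → ℝ, (∀ k, 0 ≤ p k) → (∀ k, 0 ≤ q k) →
      (∀ k, (p k - phat k) ^ 2 ≤ p k * q k) →
      ∑ k, ((φ k + η) * p k - ω * q k) ≤ V + η - ω * γ := by
  obtain ⟨f, u, hu1, hu2⟩ := geometric_hahn_banach_closed_point
    (chiAttain_convex K phat φ) (chiAttain_closed K phat φ) hV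
  obtain ⟨a, b, c, hf⟩ : ∃ a b c : ℝ, ∀ x y z, f (x, y, z) = a * x + b * y + c * z := by
    refine ⟨f (1, 0, 0), f (0, 1, 0), f (0, 0, 1), fun x y z => ?_⟩
    have : ((x, y, z) : ℝ × ℝ × ℝ) = x • (1, 0, 0) + y • (0, 1, 0) + z • (0, 0, 1) := by simp
    rw [this, map_add, map_add, map_smul, map_smul, map_smul]
    simp [mul_comm]
  rw [hf] at hu2
  have base : ∀ y z : ℝ, 0 ≤ y → z ≤ ∑ k, φ k * phat k → a + b * y + c * z < u := by
    intro y z hy hz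
    have := hu1 (1, y, z) ⟨phat, 0, hphat, fun _ => le_rfl, by simp, hphatsum, by simpa using hy, hz⟩
    rw [hf] at this; linarith
  set Z := ∑ k, φ k * phat k with hZ
  have hb : b ≤ 0 := by
    by_contra! hb
    have h1 := base (|u - a - c * Z| / b) Z (by positivity) le_rfl
    rw [mul_div_cancel₀ _ hb.ne'] at h1
    linarith [le_abs_self (u - a - c * Z)]
  have hc0 : 0 < c := by
    have h0 := base γ Z hγ le_rfl
    by_contra! hc
    have hVZ : c * (V - Z) > 0 := by linarith
    have hc' : c < 0 := lt_of_le_of_ne hc (by rintro rfl; simp at hVZ)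
    have : V < Z := by nlinarith
    have := base γ V hγ this.le
    linarith
  refine ⟨-b / c, a / c, div_nonneg (by linarith) hc0.le, fun p q hp hq hpq => ?_⟩
  have h := hu1 (∑ k, p k, ∑ k, q k, ∑ k, φ k * p k) ⟨p, q, hp, hq, hpq, rfl, le_rfl, le_rfl⟩
  rw [hf] at h
  have e : ∑ k, ((φ k + a / c) * p k - -b / c * q k)
      = ∑ k, φ k * p k + a / c * ∑ k, p k + b / c * ∑ k, q k := by
    rw [Finset.mul_sum, Finset.mul_sum, ← Finset.sum_add_distrib, ← Finset.sum_add_distrib]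
    exact Finset.sum_congr rfl fun k _ => by ring
  rw [e]
  refine le_of_mul_le_mul_left ?_ hc0
  have e1 : c * (∑ k, φ k * p k + a / c * ∑ k, p k + b / c * ∑ k, q k)
     = a * ∑ k, p k + b * ∑ k, q k + c * ∑ k, φ k * p k := by field_simp; ring
  have e2 : c * (V + a / c - -b / c * γ) = a * 1 + b * γ + c * V := by field_simp; ring
  rw [e1, e2]; linarith

/-- Strong duality up to `δ`. -/
lemma chi_strong (K : ℕ) (phat : Fin K → ℝ) (hphat : ∀ k, 0 ≤ phat k) (hphatsum : ∑ k, phat k = 1)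
    (γ : ℝ) (hγ : 0 ≤ γ) (φ : Fin K → ℝ) (V δ : ℝ) (hδ : 0 < δ)
    (hV : (1, γ, V) ∉ chiAttain K phat φ) :
    ∃ ω η : ℝ, 0 ≤ ω ∧ (∀ k, φ k + η ≤ ω) ∧
      γ * ω - η - 2 * (∑ k, phat k * Real.sqrt (ω * (ω - (φ k + η)))) + 2 * ω * (∑ k, phat k)
        ≤ V + K * δ := by
  obtain ⟨ω, η, hω, H⟩ := chi_mult K phat hphat hphatsum γ hγ φ V hV
  have ht : ∀ k, φ k + η ≤ ω := by
    intro k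
    by_contra! hk
    set C := V + η - ω * γ - ∑ j, (φ j + η) * phat j with hC
    set d := φ k + η - ω with hd
    have hd0 : 0 < d := by linarith
    set m := (|C| + 1) / d with hm
    have hm0 : 0 < m := by positivity
    have h := H (fun j => phat j + if j = k then m else 0) (fun j => if j = k then m else 0)
      (fun j => by have := hphat j; positivity) (fun j => by positivity)
      (fun j => by
        have := hphat j
        by_cases hj : j = k
        · simp only [hj, if_true]; rw [hj] at this; nlinarith
        · simp [hj])
    have e : ∑ j, ((φ j + η) * (phat j + if j = k then m else 0) - ω * (if j = k then m else 0))
        = ∑ j, (φ j + η) * phat j + d * m := by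
      have : d * m = ∑ j, if j = k then d * m else 0 := by simp
      rw [this, ← Finset.sum_add_distrib]
      refine Finset.sum_congr rfl fun j _ => ?_
      by_cases hj : j = k
      · simp only [hj, if_true, hd]; ring
      · simp [hj]
    rw [e, hm, mul_div_cancel₀ _ hd0.ne'] at h
    linarith [le_abs_self C]
  refine ⟨ω, η, hω, ht, ?_⟩
  choose p q hp hq hpq hv using fun k => chi_conj (hphat k) hω (ht k) hδ
  have h1 := H p q hp hq hpq
  have h2 := Finset.sum_le_sum (fun k (_ : k ∈ Finset.univ) => hv k)
  simp only [Finset.sum_sub_distrib _ _, ← Finset.mul_sum] at h1 h2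
  simp at h2
  linarith

/-- **SOCP duality for linear optimization over the χ² uncertainty set**
(Proposition 3 / Ben-Tal et al. Theorem 4.1). For a probability vector `p̂`, radius `γ ≥ 0`,
and any `φ ∈ ℝ^K`, the maximum of `φᵀp` over the χ² uncertainty set `Δ` (in second-order-cone
form) equals the optimal value of the dual second-order cone program. -/
theorem chi_square_socp_duality
    (K : ℕ) (phat : Fin K → ℝ) (hphat : ∀ k, 0 ≤ phat k) (hphatsum : ∑ k, phat k = 1)
    (γ : ℝ) (hγ : 0 ≤ γ) (φ : Fin K → ℝ) :
    sSup {z : ℝ | ∃ p : Fin K → ℝ, (∀ k, 0 ≤ p k) ∧ (∑ k, p k = 1) ∧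
        (∃ q : Fin K → ℝ, (∀ k, 0 ≤ q k) ∧ (∑ k, q k ≤ γ) ∧
          ∀ k, (p k - phat k) ^ 2 ≤ p k * q k) ∧
        z = ∑ k, φ k * p k}
      = sInf {z : ℝ | ∃ (ω η : ℝ) (r s : Fin K → ℝ), 0 ≤ ω ∧
          (∀ k, φ k ≤ s k) ∧ (∀ k, s k + η ≤ ω) ∧
          (∀ k, Real.sqrt (4 * (r k) ^ 2 + (s k + η) ^ 2) ≤ 2 * ω - s k - η) ∧
          z = γ * ω - η - 2 * (∑ k, phat k * r k) + 2 * ω * (∑ k, phat k)} := by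
  set P := {z : ℝ | ∃ p : Fin K → ℝ, (∀ k, 0 ≤ p k) ∧ (∑ k, p k = 1) ∧
        (∃ q : Fin K → ℝ, (∀ k, 0 ≤ q k) ∧ (∑ k, q k ≤ γ) ∧
          ∀ k, (p k - phat k) ^ 2 ≤ p k * q k) ∧
        z = ∑ k, φ k * p k} with hP
  set D := {z : ℝ | ∃ (ω η : ℝ) (r s : Fin K → ℝ), 0 ≤ ω ∧
          (∀ k, φ k ≤ s k) ∧ (∀ k, s k + η ≤ ω) ∧
          (∀ k, Real.sqrt (4 * (r k) ^ 2 + (s k + η) ^ 2) ≤ 2 * ω - s k - η) ∧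
          z = γ * ω - η - 2 * (∑ k, phat k * r k) + 2 * ω * (∑ k, phat k)} with hD
  have weak : ∀ z ∈ P, ∀ d ∈ D, z ≤ d := by
    rintro z ⟨p, hp, hp1, ⟨q, hq, hqγ, hpq⟩, rfl⟩ d ⟨ω, η, r, s, hω, hs, ht, hr, rfl⟩
    have hk : ∀ k, φ k * p k + η * p k ≤ ω * q k - 2 * (phat k * r k) + 2 * ω * phat k := by
      intro k
      have h1 := (chi_soc (r := r k) hω (ht k)).1 (by have := hr k; rwa [sub_sub] at this)
      have h2 := chi_weak (hp k) (hq k) (hphat k) hω (ht k) (hpq k) h1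
      have h3 := mul_le_mul_of_nonneg_right (hs k) (hp k)
      linarith
    have h := Finset.sum_le_sum (fun k (_ : k ∈ Finset.univ) => hk k)
    simp only [Finset.sum_sub_distrib, Finset.sum_add_distrib, ← Finset.mul_sum] at h
    rw [hp1] at h
    have := mul_le_mul_of_nonneg_left hqγ hω
    linarith
  have hPne : P.Nonempty :=
    ⟨_, phat, hphat, hphatsum, ⟨0, fun _ => le_rfl, by simpa using hγ, by simp⟩, rfl⟩
  have hDne : D.Nonempty := by
    have hM : ∀ k, φ k + -∑ j, |φ j| ≤ 0 := fun k => by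
      have := Finset.single_le_sum (f := fun j => |φ j|) (fun i _ => abs_nonneg _)
        (Finset.mem_univ k)
      linarith [le_abs_self (φ k)]
    refine ⟨_, 0, -∑ j, |φ j|, 0, φ, le_rfl, fun _ => le_rfl, hM, fun k => ?_, rfl⟩
    rw [sub_sub]
    exact (chi_soc le_rfl (hM k)).2 (by simp)
  have hPb : BddAbove P := by
    obtain ⟨d, hd⟩ := hDne
    exact ⟨d, fun z hz => weak z hz d hd⟩
  have hDb : BddBelow D := by
    obtain ⟨z, hz⟩ := hPne
    exact ⟨z, fun d hd => weak z hz d hd⟩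
  apply le_antisymm
  · exact csSup_le hPne fun z hz => le_csInf hDne fun d hd => weak z hz d hd
  · refine le_of_forall_pos_le_add fun ε hε => ?_
    have hV : (1, γ, sSup P + ε / 2) ∉ chiAttain K phat φ := by
      rintro ⟨p, q, hp, hq, hpq, h1, h2, h3⟩
      have := le_csSup hPb (show ∑ k, φ k * p k ∈ P from ⟨p, hp, h1, ⟨q, hq, h2, hpq⟩, rfl⟩)
      simp only at h3
      linarith
    obtain ⟨ω, η, hω, ht, hle⟩ := chi_strong K phat hphat hphatsum γ hγ φ _ (ε / 2 / (K + 1))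
      (by positivity) hV
    refine (csInf_le hDb ⟨ω, η, fun k => Real.sqrt (ω * (ω - (φ k + η))), φ, hω, fun _ => le_rfl,
      ht, fun k => ?_, rfl⟩).trans (hle.trans ?_)
    · rw [sub_sub]
      refine (chi_soc hω (ht k)).2 (le_of_eq (Real.sq_sqrt ?_))
      exact mul_nonneg hω (by linarith [ht k])
    · have : (K : ℝ) * (ε / 2 / (K + 1)) ≤ ε / 2 := by
        rw [mul_div_assoc', div_le_iff₀ (by positivity)]
        nlinarith
      linarith
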